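/- arXiv:2404.06164 — 4 statements merged into one kernel-verified Lean document; each statement's English description precedes it below -/
import Mathlib

section
/- Let k be a field containing a primitive third root of unity ξ, and let n ≥ 0. Let γ : k^{n+3} → k^{n+3} be the linear map sending (x₁, x₂, x₃, x₄, …, x_{n+3}) to (x₁, ξx₂, ξ²x₃, ξx₄, …, ξx_{n+3}). If a point x ∈ k^{n+3} satisfies x₁³ + x₂³ + x₃³ = 0 and γ(x) = x or γ(γ(x)) = x, then x = 0. In other words, the action of the cyclic group generated by γ on the affine cone {x₁³ + x₂³ + x₃³ = 0} ⊆ k^{n+3} is free away from the origin. -/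
/-- The action of the cyclic group generated by the diagonal automorphism
`γ = diag(1, ξ, ξ², ξ, …, ξ)` on the affine cone `{x₁³ + x₂³ + x₃³ = 0} ⊆ k^{n+3}`
is free away from the origin. -/
theorem stmt_1 (k : Type*) [Field k] (ξ : k) (hξ1 : ξ ≠ 1) (hξ3 : ξ ^ 3 = 1)
    (n : ℕ) (γ : (Fin (n + 3) → k) → (Fin (n + 3) → k))
    (hγ : ∀ y : Fin (n + 3) → k, ∀ i : Fin (n + 3),
      γ y i = (if (i : ℕ) = 0 then 1 else if (i : ℕ) = 1 then ξ
        else if (i : ℕ) = 2 then ξ ^ 2 else ξ) * y i)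
    (x : Fin (n + 3) → k) (hf : x 0 ^ 3 + x 1 ^ 3 + x 2 ^ 3 = 0)
    (hfix : γ x = x ∨ γ (γ x) = x) :
    x = 0 := by
  have hξ2 : ξ ^ 2 ≠ 1 := fun h => hξ1 (by linear_combination hξ3 - ξ * h)
  have eq_zero_of_mul_eq : ∀ c a : k, c ≠ 1 → c * a = a → a = 0 := by
    intro c a hc h
    have h' : (c - 1) * a = 0 := by linear_combination h
    exact (mul_eq_zero.mp h').resolve_left (sub_ne_zero.mpr hc)
  have hx : ∀ i : Fin (n + 3), (i : ℕ) ≠ 0 → x i = 0 := by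
    intro i hi
    rcases hfix with h | h
    · have h' := congrFun h i
      rw [hγ, if_neg hi] at h'
      split_ifs at h'
      · exact eq_zero_of_mul_eq _ _ hξ1 h'
      · exact eq_zero_of_mul_eq _ _ hξ2 h'
      · exact eq_zero_of_mul_eq _ _ hξ1 h'
    · have h' := congrFun h i
      rw [hγ, hγ, if_neg hi] at h'
      split_ifs at h'
      · exact eq_zero_of_mul_eq _ _ hξ2 (by linear_combination h')
      · exact eq_zero_of_mul_eq _ _ hξ1 (by linear_combination h' - ξ * x i * hξ3)
      · exact eq_zero_of_mul_eq _ _ hξ2 (by linear_combination h')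
  have hx1 : x 1 = 0 := hx 1 (by simp)
  have hx2 : x 2 = 0 := hx 2 (by rw [Fin.val_two]; exact two_ne_zero)
  have hx0 : x 0 = 0 := by simpa [hx1, hx2] using hf
  funext i
  by_cases hi : (i : ℕ) = 0
  · rw [show i = 0 from Fin.ext hi, hx0, Pi.zero_apply]
  · exact hx i hi
end

section
/- Let k be a field containing a primitive third root of unity ξ. Let j ∈ {1, 2} and let v = (v₁, v₂, v₃) ∈ k³ be a nonzero vector with v₁³ + v₂³ + v₃³ = 0. Then for every λ ∈ k one has (v₁, ξ^j v₂, ξ^{2j} v₃) ≠ (λv₁, λv₂, λv₃). Equivalently, the automorphism of the projective plane over k induced by the diagonal matrix diag(1, ξ^j, ξ^{2j}) has no fixed point on the Fermat cubic curve {[X₁ : X₂ : X₃] : X₁³ + X₂³ + X₃³ = 0}. -/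
theorem eq_zero_of_diag_eigenvector_of_fermat_cubic {k : Type*} [Field k] {ω : k} (h1 : ω ≠ 1)
    (h3 : ω ^ 3 = 1) {x y z c : k} (hf : x ^ 3 + y ^ 3 + z ^ 3 = 0)
    (hx : x = c * x) (hy : ω * y = c * y) (hz : ω ^ 2 * z = c * z) :
    x = 0 ∧ y = 0 ∧ z = 0 := by
  have h0 : ω ≠ 0 := by rintro rfl; simp at h3
  have h2 : ω ^ 2 ≠ 1 := fun h => h1 (by linear_combination h3 - ω * h)
  have hxy : x = 0 ∨ y = 0 := by
    have : (ω - 1) * (x * y) = 0 := by linear_combination x * hy - y * hx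
    simpa [sub_eq_zero, h1] using this
  have hxz : x = 0 ∨ z = 0 := by
    have : (ω ^ 2 - 1) * (x * z) = 0 := by linear_combination x * hz - z * hx
    simpa [sub_eq_zero, h2] using this
  have hyz : y = 0 ∨ z = 0 := by
    have : ω * (ω - 1) * (y * z) = 0 := by linear_combination y * hz - z * hy
    simpa [sub_eq_zero, h0, h1] using this
  clear hx hy hz
  rcases hxy with h | h <;> rcases hxz with h' | h' <;> rcases hyz with h'' | h'' <;> simp_all

/-- The automorphism of the projective plane induced by `diag(1, ξ^j, ξ^{2j})` (for
`j ∈ {1,2}` and `ξ` a primitive third root of unity) has no fixed point on the Fermat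
cubic curve `{X₁³ + X₂³ + X₃³ = 0}`: for any nonzero `v = (v₁, v₂, v₃)` with
`v₁³ + v₂³ + v₃³ = 0` and any `λ`, we have `(v₁, ξ^j v₂, ξ^{2j} v₃) ≠ (λv₁, λv₂, λv₃)`. -/
theorem stmt_2 (k : Type*) [Field k] (ξ : k) (hξ1 : ξ ≠ 1) (hξ3 : ξ ^ 3 = 1)
    (j : ℕ) (hj : j = 1 ∨ j = 2) (v₁ v₂ v₃ : k)
    (hv : ¬(v₁ = 0 ∧ v₂ = 0 ∧ v₃ = 0))
    (hf : v₁ ^ 3 + v₂ ^ 3 + v₃ ^ 3 = 0) (lam : k) :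
    ¬(v₁ = lam * v₁ ∧ ξ ^ j * v₂ = lam * v₂ ∧ ξ ^ (2 * j) * v₃ = lam * v₃) := by
  rintro ⟨hx, hy, hz⟩
  have h1 : ξ ^ j ≠ 1 := by
    rcases hj with rfl | rfl
    · simpa using hξ1
    · exact fun h => hξ1 (by linear_combination hξ3 - ξ * h)
  have h3 : (ξ ^ j) ^ 3 = 1 := by rw [← pow_mul, mul_comm, pow_mul, hξ3, one_pow]
  rw [mul_comm 2 j, pow_mul] at hz
  exact hv (eq_zero_of_diag_eigenvector_of_fermat_cubic h1 h3 hf hx hy hz)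
end

section
/- Let k be an algebraically closed field of characteristic zero containing a primitive third root of unity ξ. Let γ₇ be the k-algebra automorphism of R = k[x₁, …, x₇] determined by x₁ ↦ x₁, x₂ ↦ ξx₂, x₃ ↦ ξ²x₃, x₄ ↦ ξx₄, x₅ ↦ ξx₅, x₆ ↦ x₆, x₇ ↦ x₇, generating a cyclic group G of order 3, and let g = x₁³ + x₂³ + x₃³ + x₆x₇ ∈ R^G. Let γ₅ be the k-algebra automorphism of R' = k[x₁, …, x₅] determined by x₁ ↦ x₁, x₂ ↦ ξx₂, x₃ ↦ ξ²x₃, x₄ ↦ ξx₄, x₅ ↦ ξx₅, generating a cyclic group G' of order 3, and let f = x₁³ + x₂³ + x₃³ ∈ (R')^{G'}. Then there is an isomorphism of k-algebras R^G/(g, x₇) ≅ (R'^{G'}/(f))[x₆], where (g, x₇) denotes the ideal of the invariant ring R^G generated by g and x₇, and (f) denotes the ideal of R'^{G'} generated by f. -/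
open MvPolynomial

namespace AlgHom

variable {k S : Type*} [CommRing k] [CommRing S] [Algebra k S]

/-- Over the subalgebra fixed by an endomorphism `γ`, polynomials are exactly the polynomials
fixed by `γ` applied coefficientwise. -/
theorem exists_map_val_eq_of_map_eq_self (γ : S →ₐ[k] S) (q : Polynomial S)
    (hq : Polynomial.mapAlgHom γ q = q) :
    ∃ r : Polynomial (AlgHom.equalizer γ (AlgHom.id k S)),
      Polynomial.mapAlgHom (AlgHom.equalizer γ (AlgHom.id k S)).val r = q := by
  have h : q ∈ Polynomial.lifts
      ((AlgHom.equalizer γ (AlgHom.id k S)).val : AlgHom.equalizer γ (AlgHom.id k S) →+* S) := by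
    rw [Polynomial.lifts_iff_coeff_lifts]
    intro n
    have hn : γ (q.coeff n) = q.coeff n := by
      simpa using congrArg (fun p => Polynomial.coeff p n) hq
    exact ⟨⟨q.coeff n, hn⟩, rfl⟩
  obtain ⟨r, hr⟩ := (Polynomial.mem_lifts q).1 h
  exact ⟨r, hr⟩

theorem mapAlgHom_val_injective (A : Subalgebra k S) :
    Function.Injective (Polynomial.mapAlgHom A.val) :=
  Polynomial.map_injective (A.val : A →+* S) Subtype.val_injective

variable {R : Type*} [CommRing R] [Algebra k R]

/-- An algebra map `R → S[T]` intertwining `δ` with the coefficientwise action of `γ` restricts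
to the fixed subalgebras. -/
theorem exists_equalizer_polynomial_lift (δ : R →ₐ[k] R) (γ : S →ₐ[k] S)
    (θ : R →ₐ[k] Polynomial S) (h : (Polynomial.mapAlgHom γ).comp θ = θ.comp δ) :
    ∃ Φ : AlgHom.equalizer δ (AlgHom.id k R) →ₐ[k]
        Polynomial (AlgHom.equalizer γ (AlgHom.id k S)),
      ∀ b, Polynomial.mapAlgHom (AlgHom.equalizer γ (AlgHom.id k S)).val (Φ b) = θ b := by
  let j := Polynomial.mapAlgHom (AlgHom.equalizer γ (AlgHom.id k S)).val
  have hj : Function.Injective j := mapAlgHom_val_injective _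
  have hmem : ∀ b : AlgHom.equalizer δ (AlgHom.id k R),
      (θ.comp (AlgHom.equalizer δ (AlgHom.id k R)).val) b ∈ j.range := by
    intro b
    refine exists_map_val_eq_of_map_eq_self γ (θ b) ?_
    have hb : δ b = b := b.2
    simpa [hb] using DFunLike.congr_fun h (b : R)
  refine ⟨((AlgEquiv.ofInjective j hj).symm : j.range →ₐ[k] _).comp
    (AlgHom.codRestrict _ j.range hmem), fun b => ?_⟩
  exact congrArg Subtype.val ((AlgEquiv.ofInjective j hj).apply_symm_apply
    (AlgHom.codRestrict _ j.range hmem b))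

/-- A surjection `Φ : R → S[T]` with kernel `(x)` sending `g` to the constant `f` induces
`R/(g, x) ≃ (S/(f))[T]`. -/
theorem nonempty_quotient_span_pair_algEquiv_polynomial (Φ : R →ₐ[k] Polynomial S)
    (hsurj : Function.Surjective Φ) (g x : R) (f : S) (hker : RingHom.ker Φ = Ideal.span {x})
    (hg : Φ g = Polynomial.C f) :
    Nonempty ((R ⧸ Ideal.span {g, x}) ≃ₐ[k] Polynomial (S ⧸ Ideal.span {f})) := by
  let π := Polynomial.mapAlgHom (Ideal.Quotient.mkₐ k (Ideal.span {f}))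
  have hπ : Function.Surjective π :=
    Polynomial.map_surjective _ (Ideal.Quotient.mkₐ_surjective k _)
  have hπker : RingHom.ker π = Ideal.span {Polynomial.C f} := by
    have h := Polynomial.ker_mapRingHom (Ideal.Quotient.mk (Ideal.span {f}))
    rw [Ideal.mk_ker, Ideal.map_span, Set.image_singleton] at h
    exact h
  have hkerall : RingHom.ker (π.comp Φ) = Ideal.span {g, x} := by
    have h := Ideal.comap_map_of_surjective Φ hsurj (Ideal.span {g})
    rw [Ideal.map_span, Set.image_singleton, hg, ← hπker, ← RingHom.ker_eq_comap_bot, hker,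
      ← Ideal.span_union, Set.singleton_union] at h
    exact h
  exact ⟨(Ideal.quotientEquivAlgOfEq k hkerall.symm).trans
    (Ideal.quotientKerAlgEquivOfSurjective (f := π.comp Φ) (hπ.comp hsurj))⟩

/-- If `θ : R → S[T]` has a section `s`, both are equivariant, and the kernel of `θ` is
generated by a fixed nonzerodivisor `x`, then on fixed subalgebras, dividing by `x` and by any
`g` that `θ` sends to the constant `f` yields the polynomial ring over the quotient by `f`. -/
theorem nonempty_equalizer_quotient_algEquiv_polynomial [IsDomain R]
    (δ : R →ₐ[k] R) (γ : S →ₐ[k] S) (θ : R →ₐ[k] Polynomial S) (s : Polynomial S →ₐ[k] R)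
    (hθ : (Polynomial.mapAlgHom γ).comp θ = θ.comp δ)
    (hs : s.comp (Polynomial.mapAlgHom γ) = δ.comp s)
    (hθs : θ.comp s = AlgHom.id k _)
    (g x : AlgHom.equalizer δ (AlgHom.id k R)) (f : AlgHom.equalizer γ (AlgHom.id k S))
    (hx0 : (x : R) ≠ 0) (hker : ∀ p, θ p = 0 ↔ (x : R) ∣ p)
    (hg : θ g = Polynomial.C (f : S)) :
    Nonempty ((AlgHom.equalizer δ (AlgHom.id k R) ⧸ Ideal.span {g, x}) ≃ₐ[k]
      Polynomial (AlgHom.equalizer γ (AlgHom.id k S) ⧸ Ideal.span {f})) := by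
  obtain ⟨Φ, hΦ⟩ := exists_equalizer_polynomial_lift δ γ θ hθ
  have hj := mapAlgHom_val_injective (AlgHom.equalizer γ (AlgHom.id k S))
  have hsurj : Function.Surjective Φ := by
    intro q
    let q' := Polynomial.mapAlgHom (AlgHom.equalizer γ (AlgHom.id k S)).val q
    have hq' : Polynomial.mapAlgHom γ q' = q' := by
      ext n
      have hn : γ (q.coeff n) = q.coeff n := (q.coeff n).2
      simpa [q'] using hn
    have hinv : δ (s q') = s q' := by
      have := DFunLike.congr_fun hs q'
      simp only [AlgHom.comp_apply, hq'] at this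
      exact this.symm
    refine ⟨⟨s q', hinv⟩, hj ?_⟩
    rw [hΦ]
    exact DFunLike.congr_fun hθs q'
  have hkerΦ : RingHom.ker Φ = Ideal.span {x} := by
    ext b
    have hb0 : Φ b = 0 ↔ (x : R) ∣ b := by
      rw [← hker, ← hΦ, map_eq_zero_iff _ hj]
    rw [RingHom.mem_ker, Ideal.mem_span_singleton]
    refine hb0.trans ⟨?_, fun ⟨c, hc⟩ => ⟨c, by rw [hc]; rfl⟩⟩
    rintro ⟨c, hc⟩
    have hxi : δ x = x := x.2
    have hbi : δ b = b := b.2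
    have hci : δ c = c := by
      rw [hc, map_mul, hxi] at hbi
      exact mul_left_cancel₀ hx0 hbi
    exact ⟨⟨c, hci⟩, Subtype.ext hc⟩
  have hΦg : Φ g = Polynomial.C f := hj (by rw [hΦ, hg]; simp)
  exact nonempty_quotient_span_pair_algEquiv_polynomial Φ hsurj g x f hkerΦ hΦg

end AlgHom

/-- With `G = ⟨γ₇⟩` acting on `R = k[x₁, …, x₇]` by
`γ₇ = diag(1, ξ, ξ², ξ, ξ, 1, 1)`, `g = x₁³ + x₂³ + x₃³ + x₆x₇ ∈ R^G`, and
`G' = ⟨γ₅⟩` acting on `R' = k[x₁, …, x₅]` by `γ₅ = diag(1, ξ, ξ², ξ, ξ)`,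
`f = x₁³ + x₂³ + x₃³ ∈ R'^{G'}`, there is a `k`-algebra isomorphism
`R^G/(g, x₇) ≅ (R'^{G'}/(f))[x₆]`. -/
theorem stmt_8 (k : Type*) [Field k] [IsAlgClosed k] [CharZero k]
    (ξ : k) (hξ1 : ξ ≠ 1) (hξ3 : ξ ^ 3 = 1)
    (γ₇ : MvPolynomial (Fin 7) k →ₐ[k] MvPolynomial (Fin 7) k)
    (hγ₇ : ∀ i : Fin 7, γ₇ (X i) = ![(1 : k), ξ, ξ ^ 2, ξ, ξ, 1, 1] i • X i)
    (γ₅ : MvPolynomial (Fin 5) k →ₐ[k] MvPolynomial (Fin 5) k)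
    (hγ₅ : ∀ i : Fin 5, γ₅ (X i) = ![(1 : k), ξ, ξ ^ 2, ξ, ξ] i • X i)
    (g : AlgHom.equalizer γ₇ (AlgHom.id k (MvPolynomial (Fin 7) k)))
    (hg : (g : MvPolynomial (Fin 7) k) = X 0 ^ 3 + X 1 ^ 3 + X 2 ^ 3 + X 5 * X 6)
    (x₇ : AlgHom.equalizer γ₇ (AlgHom.id k (MvPolynomial (Fin 7) k)))
    (hx₇ : (x₇ : MvPolynomial (Fin 7) k) = X 6)
    (f : AlgHom.equalizer γ₅ (AlgHom.id k (MvPolynomial (Fin 5) k)))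
    (hf : (f : MvPolynomial (Fin 5) k) = X 0 ^ 3 + X 1 ^ 3 + X 2 ^ 3) :
    Nonempty
      ((AlgHom.equalizer γ₇ (AlgHom.id k (MvPolynomial (Fin 7) k)) ⧸
          Ideal.span {g, x₇}) ≃ₐ[k]
        Polynomial
          (AlgHom.equalizer γ₅ (AlgHom.id k (MvPolynomial (Fin 5) k)) ⧸
            Ideal.span {f})) := by
  let θ : MvPolynomial (Fin 7) k →ₐ[k] Polynomial (MvPolynomial (Fin 5) k) :=
    aeval ![Polynomial.C (X 0), Polynomial.C (X 1), Polynomial.C (X 2), Polynomial.C (X 3),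
      Polynomial.C (X 4), Polynomial.X, 0]
  let ι : MvPolynomial (Fin 5) k →ₐ[k] MvPolynomial (Fin 7) k :=
    aeval ![X 0, X 1, X 2, X 3, X 4]
  let s : Polynomial (MvPolynomial (Fin 5) k) →ₐ[k] MvPolynomial (Fin 7) k :=
    Polynomial.eval₂AlgHom ι (X 5) fun _ => Commute.all _ _
  have hsC (a) : s (Polynomial.C a) = ι a := Polynomial.eval₂_C _ _
  have hsX : s Polynomial.X = X 5 := Polynomial.eval₂_X _ _
  have hι (i) : ι (X i) = ![X 0, X 1, X 2, X 3, X 4] i := aeval_X _ _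
  have hθX (i) : θ (X i) = ![Polynomial.C (X 0), Polynomial.C (X 1), Polynomial.C (X 2),
      Polynomial.C (X 3), Polynomial.C (X 4), Polynomial.X, 0] i := aeval_X _ _
  have hCsmul (c : k) (a : MvPolynomial (Fin 5) k) :
      Polynomial.C (c • a) = c • Polynomial.C a := (Polynomial.smul_C c a).symm
  refine AlgHom.nonempty_equalizer_quotient_algEquiv_polynomial γ₇ γ₅ θ s ?_ ?_ ?_ g x₇ f ?_ ?_ ?_
  · refine MvPolynomial.algHom_ext fun i => ?_
    simp only [AlgHom.comp_apply, hγ₇, map_smul, hθX]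
    fin_cases i <;> simp [hγ₅, -Polynomial.smul_C, hCsmul]
  · refine Polynomial.algHom_ext' (MvPolynomial.algHom_ext fun i => ?_) ?_
    · simp [Polynomial.CAlgHom, hsC, hγ₅, hι]
      fin_cases i <;> simp [hγ₇]
    · simp [hsX, hγ₇]
  · refine Polynomial.algHom_ext' (MvPolynomial.algHom_ext fun i => ?_) ?_
    · simp [Polynomial.CAlgHom, hsC, hι]
      fin_cases i <;> simp [hθX]
    · simp [hsX, hθX]
  · rw [hx₇]
    exact X_ne_zero 6
  · intro p
    rw [hx₇]
    constructor
    · intro hp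
      let mkX := Ideal.Quotient.mkₐ k (Ideal.span {(X 6 : MvPolynomial (Fin 7) k)})
      have h : mkX.comp (s.comp θ) = mkX := by
        refine MvPolynomial.algHom_ext fun i => ?_
        have h6 : mkX (X 6) = 0 :=
          Ideal.Quotient.eq_zero_iff_mem.2 (Ideal.mem_span_singleton_self _)
        simp only [AlgHom.comp_apply, hθX]
        fin_cases i <;> simp [hsC, hsX, hι, h6]
      have hmk := DFunLike.congr_fun h p
      simp only [AlgHom.comp_apply, hp, map_zero] at hmk
      exact Ideal.mem_span_singleton.1 (Ideal.Quotient.eq_zero_iff_mem.1 hmk.symm)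
    · rintro ⟨c, rfl⟩
      simp [hθX]
  · rw [hg, hf]
    simp [hθX]
end

section
/- Let k be an algebraically closed field of characteristic zero containing a primitive third root of unity ξ. Let γ₇ be the k-algebra automorphism of R = k[x₁, …, x₇] determined by x₁ ↦ x₁, x₂ ↦ ξx₂, x₃ ↦ ξ²x₃, x₄ ↦ ξx₄, x₅ ↦ ξx₅, x₆ ↦ x₆, x₇ ↦ x₇, generating a cyclic group G of order 3, and let g = x₁³ + x₂³ + x₃³ + x₆x₇ ∈ R^G. Let γ₅ be the k-algebra automorphism of R' = k[x₁, …, x₅] determined by x₁ ↦ x₁, x₂ ↦ ξx₂, x₃ ↦ ξ²x₃, x₄ ↦ ξx₄, x₅ ↦ ξx₅, generating a cyclic group G' of order 3. Then for every t ∈ k with t ≠ 0, there is an isomorphism of k-algebras R^G/(g, x₇ − t) ≅ R'^{G'}, where (g, x₇ − t) denotes the ideal of the invariant ring R^G generated by g and x₇ − t. -/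
open MvPolynomial

/-- Averaging over an automorphism of order dividing three: an element fixed by `γ` which lies in
the ideal of `A` generated by two fixed elements lies in the ideal they generate in the
subalgebra of fixed elements. -/
theorem mem_span_pair_equalizer_of_coe_mem {k A : Type*} [Field k] [CharZero k] [CommRing A]
    [Algebra k A] {γ : A →ₐ[k] A} (hγ : ∀ x, γ (γ (γ x)) = x)
    {a b f : AlgHom.equalizer γ (AlgHom.id k A)}
    (hf : (f : A) ∈ Ideal.span {(a : A), (b : A)}) : f ∈ Ideal.span {a, b} := by
  have fixed (x : AlgHom.equalizer γ (AlgHom.id k A)) : γ x = x := x.2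
  have average_mem (x : A) :
      (3⁻¹ : k) • (x + γ x + γ (γ x)) ∈ AlgHom.equalizer γ (AlgHom.id k A) := by
    rw [AlgHom.mem_equalizer, AlgHom.id_apply, map_smul, map_add, map_add, hγ]
    congr 1
    ring
  obtain ⟨c, d, h⟩ := Ideal.mem_span_pair.1 hf
  have h₁ := congrArg γ h
  have h₂ := congrArg γ h₁
  simp only [map_add, map_mul, fixed] at h₁ h₂
  refine Ideal.mem_span_pair.2 ⟨⟨_, average_mem c⟩, ⟨_, average_mem d⟩, Subtype.ext ?_⟩
  have hsum : (f : A) + f + f = (3 : k) • (f : A) := by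
    rw [show (3 : k) = 1 + 1 + 1 by norm_num, add_smul, add_smul, one_smul]
  have hthree : (3⁻¹ : k) • ((f : A) + f + f) = f := by
    rw [hsum, smul_smul, inv_mul_cancel₀ three_ne_zero, one_smul]
  change (3⁻¹ : k) • (c + γ c + γ (γ c)) * (a : A) +
    (3⁻¹ : k) • (d + γ d + γ (γ d)) * (b : A) = f
  rw [smul_mul_assoc, smul_mul_assoc, ← smul_add, ← hthree]
  congr 1
  linear_combination h + h₁ + h₂

/-- An equivariant algebra retraction `ψ : A → B` whose kernel is generated by two fixed elements
induces an isomorphism from the corresponding quotient of the fixed subalgebra of `A` onto the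
fixed subalgebra of `B`. -/
theorem nonempty_quotient_span_pair_equalizer_algEquiv {k A B : Type*} [Field k] [CharZero k]
    [CommRing A] [Algebra k A] [CommRing B] [Algebra k B]
    {γ : A →ₐ[k] A} {σ : B →ₐ[k] B} (hγ : ∀ x, γ (γ (γ x)) = x)
    (ψ : A →ₐ[k] B) (φ : B →ₐ[k] A) (hψ : ψ.comp γ = σ.comp ψ) (hφ : φ.comp σ = γ.comp φ)
    (hψφ : ψ.comp φ = AlgHom.id k B) (a b : AlgHom.equalizer γ (AlgHom.id k A))
    (ha : ψ a = 0) (hb : ψ b = 0)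
    (hker : ∀ f, ψ f = 0 → f ∈ Ideal.span {(a : A), (b : A)}) :
    Nonempty ((AlgHom.equalizer γ (AlgHom.id k A) ⧸ Ideal.span {a, b}) ≃ₐ[k]
      AlgHom.equalizer σ (AlgHom.id k B)) := by
  let Ψ : AlgHom.equalizer γ (AlgHom.id k A) →ₐ[k] AlgHom.equalizer σ (AlgHom.id k B) :=
    (ψ.comp (AlgHom.equalizer γ (AlgHom.id k A)).val).codRestrict _ fun x ↦
      (DFunLike.congr_fun hψ (x : A)).symm.trans (congrArg ψ x.2)
  have hsurj : Function.Surjective Ψ := fun y ↦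
    ⟨⟨φ y, (DFunLike.congr_fun hφ (y : B)).symm.trans (congrArg φ y.2)⟩,
      Subtype.ext (DFunLike.congr_fun hψφ (y : B))⟩
  have hspan : Ideal.span {a, b} = RingHom.ker Ψ := by
    apply le_antisymm
    · rw [Ideal.span_le]
      rintro x (rfl | rfl)
      · exact Subtype.ext ha
      · exact Subtype.ext hb
    · intro f hf
      exact mem_span_pair_equalizer_of_coe_mem hγ (hker f (congrArg Subtype.val hf))
  exact ⟨(Ideal.quotientEquivAlgOfEq k hspan).trans
    (Ideal.quotientKerAlgEquivOfSurjective hsurj)⟩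

/-- With `G = ⟨γ₇⟩` acting on `R = k[x₁, …, x₇]` by
`γ₇ = diag(1, ξ, ξ², ξ, ξ, 1, 1)`, `g = x₁³ + x₂³ + x₃³ + x₆x₇ ∈ R^G`, and
`G' = ⟨γ₅⟩` acting on `R' = k[x₁, …, x₅]` by `γ₅ = diag(1, ξ, ξ², ξ, ξ)`,
for every `t ≠ 0` in `k` there is a `k`-algebra isomorphism
`R^G/(g, x₇ − t) ≅ R'^{G'}`. -/
theorem stmt_9 (k : Type*) [Field k] [IsAlgClosed k] [CharZero k]
    (ξ : k) (hξ1 : ξ ≠ 1) (hξ3 : ξ ^ 3 = 1)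
    (γ₇ : MvPolynomial (Fin 7) k →ₐ[k] MvPolynomial (Fin 7) k)
    (hγ₇ : ∀ i : Fin 7, γ₇ (X i) = ![(1 : k), ξ, ξ ^ 2, ξ, ξ, 1, 1] i • X i)
    (γ₅ : MvPolynomial (Fin 5) k →ₐ[k] MvPolynomial (Fin 5) k)
    (hγ₅ : ∀ i : Fin 5, γ₅ (X i) = ![(1 : k), ξ, ξ ^ 2, ξ, ξ] i • X i)
    (g : AlgHom.equalizer γ₇ (AlgHom.id k (MvPolynomial (Fin 7) k)))
    (hg : (g : MvPolynomial (Fin 7) k) = X 0 ^ 3 + X 1 ^ 3 + X 2 ^ 3 + X 5 * X 6)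
    (x₇ : AlgHom.equalizer γ₇ (AlgHom.id k (MvPolynomial (Fin 7) k)))
    (hx₇ : (x₇ : MvPolynomial (Fin 7) k) = X 6)
    (t : k) (ht : t ≠ 0) :
    Nonempty
      ((AlgHom.equalizer γ₇ (AlgHom.id k (MvPolynomial (Fin 7) k)) ⧸
          Ideal.span {g, x₇ - algebraMap k
            (AlgHom.equalizer γ₇ (AlgHom.id k (MvPolynomial (Fin 7) k))) t}) ≃ₐ[k]
        AlgHom.equalizer γ₅ (AlgHom.id k (MvPolynomial (Fin 5) k))) := by
  have hξ6 : (ξ ^ 2) ^ 3 = 1 := by rw [← pow_mul, mul_comm, pow_mul, hξ3, one_pow]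
  have hγ₇_cube (x : MvPolynomial (Fin 7) k) : γ₇ (γ₇ (γ₇ x)) = x := by
    refine DFunLike.congr_fun (f := γ₇.comp (γ₇.comp γ₇)) (g := AlgHom.id k _)
      (MvPolynomial.algHom_ext fun i ↦ ?_) x
    have hcube : ![(1 : k), ξ, ξ ^ 2, ξ, ξ, 1, 1] i ^ 3 = 1 := by
      fin_cases i <;> simp [hξ3, hξ6]
    rw [AlgHom.comp_apply, AlgHom.comp_apply, hγ₇, map_smul, hγ₇, map_smul, map_smul, hγ₇,
      smul_smul, smul_smul, ← pow_three', hcube, one_smul, AlgHom.id_apply]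
  let s : MvPolynomial (Fin 5) k := X 0 ^ 3 + X 1 ^ 3 + X 2 ^ 3
  have hs : γ₅ s = s := by
    simp [s, hγ₅, smul_pow, hξ3, hξ6]
  let ψ : MvPolynomial (Fin 7) k →ₐ[k] MvPolynomial (Fin 5) k :=
    aeval ![X 0, X 1, X 2, X 3, X 4, -(t⁻¹ • s), C t]
  let φ : MvPolynomial (Fin 5) k →ₐ[k] MvPolynomial (Fin 7) k :=
    aeval ![X 0, X 1, X 2, X 3, X 4]
  have hγ₅C (c : k) : γ₅ (C c) = C c := γ₅.commutes c
  have hφC (c : k) : φ (C c) = C c := φ.commutes c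
  refine nonempty_quotient_span_pair_equalizer_algEquiv hγ₇_cube ψ φ ?_ ?_ ?_ _ _ ?_ ?_ ?_
  · refine MvPolynomial.algHom_ext fun i ↦ ?_
    fin_cases i <;> simp [ψ, hγ₇, hγ₅, hs, hγ₅C]
  · refine MvPolynomial.algHom_ext fun i ↦ ?_
    fin_cases i <;> simp [φ, hγ₇, hγ₅]
  · refine MvPolynomial.algHom_ext fun i ↦ ?_
    fin_cases i <;> simp [φ, ψ]
  · have : (t⁻¹ • s) * C t = s := by
      rw [mul_comm, ← smul_eq_C_mul, smul_smul, mul_inv_cancel₀ ht, one_smul]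
    simp [hg, ψ, this]
    simp [s]
  · simp [hx₇, ψ, algebraMap_eq]
  · intro f hf
    let J := Ideal.span {(g : MvPolynomial (Fin 7) k), ((x₇ - algebraMap k
      (AlgHom.equalizer γ₇ (AlgHom.id k (MvPolynomial (Fin 7) k))) t :
        AlgHom.equalizer γ₇ (AlgHom.id k (MvPolynomial (Fin 7) k))) :
        MvPolynomial (Fin 7) k)}
    have hx₇J : X 6 - C t ∈ J := by
      refine Ideal.subset_span (Or.inr ?_)
      simp [hx₇, algebraMap_eq]
    have hgJ : X 0 ^ 3 + X 1 ^ 3 + X 2 ^ 3 + X 5 * X 6 ∈ J := hg ▸ Ideal.subset_span (Or.inl rfl)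
    have hmk : (Ideal.Quotient.mkₐ k J).comp (φ.comp ψ) = Ideal.Quotient.mkₐ k J := by
      refine MvPolynomial.algHom_ext fun i ↦ Ideal.Quotient.eq.2 ?_
      fin_cases i
      iterate 5 simp [φ, ψ]
      · have hCt : (C t⁻¹ * C t : MvPolynomial (Fin 7) k) = 1 := by
          rw [← C_mul, inv_mul_cancel₀ ht, C_1]
        have key := J.mul_mem_left (-C t⁻¹) (J.sub_mem hgJ (J.mul_mem_left (X 5) hx₇J))
        convert key using 1
        simp [φ, ψ, s, smul_eq_C_mul]
        linear_combination X 5 * hCt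
      · have := J.neg_mem hx₇J
        simpa [ψ, hφC] using this
    have h := DFunLike.congr_fun hmk f
    rw [AlgHom.comp_apply, AlgHom.comp_apply, hf, map_zero, map_zero] at h
    exact Ideal.Quotient.eq_zero_iff_mem.1 h.symm
end
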